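/- Let h be a local operator of range r on (ℂ²)^{⊗r} that is antisymmetric with respect to transposition in the computational basis (hᵀ = −h) and commutes with the charge on its support, [h, Σ_{k=1}^{r} Z_k] = 0, where Z_k is the Pauli Z matrix acting on the k-th tensor factor. Then for every complex number c and A = diag(1, c), the condition A^{⊗r} h + hᵀ A^{⊗r} = 0 holds; consequently, for every L ≥ r, the Hamiltonian H = Σ_{j=0}^{2L−1} h(j) on a periodic chain of 2L qubits annihilates the crosscap state |Ψ(c)⟩: H|Ψ(c)⟩ = 0. -/

import Mathlib

open Matrix BigOperators

/-- The site `j + k` modulo the chain length `n`. -/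
def shiftSite {n : ℕ} (j : Fin n) (k : ℕ) : Fin n :=
  ⟨(j.val + k) % n, Nat.mod_lt _ (Nat.lt_of_le_of_lt (Nat.zero_le _) j.isLt)⟩

/-- Site `j` (for `j < L`) viewed as a site of the chain of length `2*L`. -/
def lo {L : ℕ} (j : Fin L) : Fin (2 * L) := ⟨j.val, by have := j.isLt; omega⟩

/-- The antipodal site `j + L` of the chain of length `2*L`. -/
def hi {L : ℕ} (j : Fin L) : Fin (2 * L) := ⟨j.val + L, by have := j.isLt; omega⟩

/-- The crosscap state built from the `D × D` matrix `A` on a periodic chain of `2*L` sites: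
its coefficient on the computational basis state `f` is `∏_{j=0}^{L-1} A (f j) (f (j+L))`. -/
noncomputable def crosscap (L D : ℕ) (A : Matrix (Fin D) (Fin D) ℂ) :
    (Fin (2 * L) → Fin D) → ℂ :=
  fun f => ∏ j : Fin L, A (f (lo j)) (f (hi j))

/-- The translate `h(j)` of a local operator `h` of range `r`, acting on the sites
`j, j+1, …, j+r-1` (mod `n`) of a periodic chain of `n` sites, and as the identity elsewhere. -/
noncomputable def localOp {n D : ℕ} (r : ℕ)
    (h : Matrix (Fin r → Fin D) (Fin r → Fin D) ℂ) (j : Fin n) :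
    Matrix (Fin n → Fin D) (Fin n → Fin D) ℂ :=
  Matrix.of fun f g =>
    h (fun k => f (shiftSite j k.val)) (fun k => g (shiftSite j k.val)) *
      ∏ i : Fin n, if (∃ k : Fin r, i = shiftSite j k.val) ∨ f i = g i then 1 else 0

/-- The `r`-fold Kronecker power `A^{⊗r}` of a `D × D` matrix `A`. -/
noncomputable def kronPow {D : ℕ} (r : ℕ) (A : Matrix (Fin D) (Fin D) ℂ) :
    Matrix (Fin r → Fin D) (Fin r → Fin D) ℂ :=
  Matrix.of fun f g => ∏ k : Fin r, A (f k) (g k)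

/-- The one-site operator `M` acting at site `j`, identity elsewhere. -/
noncomputable def oneSite {n D : ℕ} (M : Matrix (Fin D) (Fin D) ℂ) (j : Fin n) :
    Matrix (Fin n → Fin D) (Fin n → Fin D) ℂ :=
  Matrix.of fun f g => M (f j) (g j) * ∏ i : Fin n, if i = j ∨ f i = g i then 1 else 0

/-- The Pauli matrix `X`. -/
noncomputable def PX : Matrix (Fin 2) (Fin 2) ℂ := !![0, 1; 1, 0]

/-- The Pauli matrix `Y`. -/
noncomputable def PY : Matrix (Fin 2) (Fin 2) ℂ := !![0, -Complex.I; Complex.I, 0]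

/-- The Pauli matrix `Z`. -/
noncomputable def PZ : Matrix (Fin 2) (Fin 2) ℂ := !![1, 0; 0, -1]

/-- The spin raising operator `σ⁺ = |1⟩⟨0|`. -/
noncomputable def sigmaPlus : Matrix (Fin 2) (Fin 2) ℂ := !![0, 0; 1, 0]

theorem shiftSite_shiftSite {n : ℕ} (j : Fin n) (a b : ℕ) :
    shiftSite (shiftSite j a) b = shiftSite j (a + b) := by
  simp [shiftSite, add_assoc]

theorem shiftSite_right_comm {n : ℕ} (j : Fin n) (a b : ℕ) :
    shiftSite (shiftSite j a) b = shiftSite (shiftSite j b) a := by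
  rw [shiftSite_shiftSite, shiftSite_shiftSite, add_comm]

theorem shiftSite_antipode_antipode {L : ℕ} (i : Fin (2 * L)) :
    shiftSite (shiftSite i L) L = i := by
  rw [shiftSite_shiftSite]
  ext
  simp [shiftSite, ← two_mul, Nat.mod_eq_of_lt i.isLt]

theorem shiftSite_right_injective {n : ℕ} (j : Fin n) {a b : ℕ} (ha : a < n) (hb : b < n)
    (hab : shiftSite j a = shiftSite j b) : a = b := by
  have hmod : (j.val + a) ≡ (j.val + b) [MOD n] := by
    simpa [shiftSite, Nat.ModEq] using hab
  exact (Nat.ModEq.add_left_cancel' _ hmod).eq_of_lt_of_lt ha hb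

theorem shiftSite_antipode_lo {L : ℕ} (j : Fin L) : shiftSite (lo j) L = hi j := by
  ext
  have := j.isLt
  exact Nat.mod_eq_of_lt (by simp only [lo]; omega)

theorem shiftSite_antipode_hi {L : ℕ} (j : Fin L) : shiftSite (hi j) L = lo j := by
  rw [← shiftSite_antipode_lo, shiftSite_antipode_antipode]

theorem eq_lo_or_eq_hi {L : ℕ} (i : Fin (2 * L)) : ∃ j : Fin L, i = lo j ∨ i = hi j := by
  by_cases hi' : i.val < L
  · exact ⟨⟨i, hi'⟩, Or.inl rfl⟩
  · refine ⟨⟨i - L, by omega⟩, Or.inr ?_⟩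
    ext
    simp only [hi]
    omega

/-- The antipodal translation of the sites of a chain of length `2*L`. -/
def antipode (L : ℕ) : Equiv.Perm (Fin (2 * L)) where
  toFun i := shiftSite i L
  invFun i := shiftSite i L
  left_inv := shiftSite_antipode_antipode
  right_inv := shiftSite_antipode_antipode

theorem sum_eq_sum_lo_add_sum_hi {L : ℕ} (F : Fin (2 * L) → ℕ) :
    ∑ i, F i = ∑ j : Fin L, F (lo j) + ∑ j : Fin L, F (hi j) := by
  refine Eq.trans ?_ (Fintype.sum_sum_type fun x => F (Sum.elim lo hi x))
  symm
  refine Fintype.sum_bijective (Sum.elim lo hi) ⟨?_, ?_⟩ _ _ ?_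
  · rintro (a | a) (b | b) hab <;> simp [lo, hi, Fin.ext_iff] at hab ⊢ <;> omega
  · intro i
    obtain ⟨j, rfl | rfl⟩ := eq_lo_or_eq_hi i
    · exact ⟨Sum.inl j, rfl⟩
    · exact ⟨Sum.inr j, rfl⟩
  · exact fun _ => rfl

/-- The number of sites in state `1`. -/
def occupation {ι : Type*} [Fintype ι] (f : ι → Fin 2) : ℕ := ∑ i, (f i).val

theorem diagonal_one_apply (c : ℂ) (a b : Fin 2) :
    Matrix.diagonal ![1, c] a b = if a = b then c ^ a.val else 0 := by
  fin_cases a <;> fin_cases b <;> simp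

theorem kronPow_diagonal (r : ℕ) (c : ℂ) :
    kronPow r (Matrix.diagonal ![1, c]) = Matrix.diagonal fun f => c ^ occupation f := by
  ext f g
  simp only [kronPow, Matrix.of_apply, diagonal_one_apply, Finset.prod_ite_zero, Finset.mem_univ,
    true_imp_iff, Finset.prod_pow_eq_pow_sum]
  simp only [Matrix.diagonal_apply, funext_iff, occupation]

theorem oneSite_PZ {n : ℕ} (k : Fin n) :
    oneSite PZ k = Matrix.diagonal fun f => 1 - 2 * ((f k).val : ℂ) := by
  ext f g
  simp only [oneSite, Matrix.of_apply, Finset.prod_ite_zero, Finset.mem_univ, true_imp_iff,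
    Finset.prod_const_one, Matrix.diagonal_apply]
  by_cases hfg : f = g
  · subst hfg
    generalize f k = a
    fin_cases a <;> norm_num [PZ]
  · rw [if_neg hfg]
    by_cases hk : f k = g k
    · rw [if_neg, mul_zero]
      exact fun H => hfg (funext fun i => (H i).elim (fun e => e ▸ hk) id)
    · have hPZ : ∀ a b : Fin 2, a ≠ b → PZ a b = 0 := by
        intro a b
        fin_cases a <;> fin_cases b <;> simp [PZ]
      rw [hPZ _ _ hk, zero_mul]

theorem sum_oneSite_PZ (n : ℕ) :
    ∑ k : Fin n, oneSite PZ k = Matrix.diagonal fun f => (n : ℂ) - 2 * (occupation f : ℂ) := by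
  ext f g
  simp only [oneSite_PZ, Matrix.sum_apply, Matrix.diagonal_apply]
  split_ifs
  · simp [occupation, Finset.mul_sum]
  · simp

/-- An operator commuting with the total charge has matrix elements only between states of equal
occupation. -/
theorem occupation_eq_of_commute {n : ℕ} {h : Matrix (Fin n → Fin 2) (Fin n → Fin 2) ℂ}
    (hcomm : h * (∑ k : Fin n, oneSite PZ k) = (∑ k : Fin n, oneSite PZ k) * h)
    {f g : Fin n → Fin 2} (hfg : h f g ≠ 0) : occupation f = occupation g := by
  have H := congrFun (congrFun hcomm f) g
  rw [sum_oneSite_PZ, Matrix.mul_diagonal, Matrix.diagonal_mul, mul_comm] at H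
  have H' := mul_right_cancel₀ hfg H
  have : (occupation f : ℂ) = occupation g := by linear_combination H' / 2
  exact_mod_cast this

/-- The states `f` and `g` agree outside the window of `r` sites starting at `j`. -/
def AgreeOutside {n D : ℕ} (r : ℕ) (j : Fin n) (f g : Fin n → Fin D) : Prop :=
  ∀ i, (∀ k : Fin r, i ≠ shiftSite j k) → f i = g i

open Classical in
theorem localOp_apply {n D r : ℕ} (h : Matrix (Fin r → Fin D) (Fin r → Fin D) ℂ) (j : Fin n)
    (f g : Fin n → Fin D) :
    localOp r h j f g = if AgreeOutside r j f g then
      h (fun k => f (shiftSite j k)) (fun k => g (shiftSite j k)) else 0 := by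
  have hiff : (∀ i, (∃ k : Fin r, i = shiftSite j k) ∨ f i = g i) ↔ AgreeOutside r j f g := by
    simp only [AgreeOutside, or_iff_not_imp_left, not_exists, ne_eq]
  simp only [localOp, Matrix.of_apply, Finset.prod_ite_zero, Finset.mem_univ, true_imp_iff,
    Finset.prod_const_one, hiff, mul_ite, mul_one, mul_zero]

theorem AgreeOutside.occupation_eq {n r : ℕ} (hr : r ≤ n) {j : Fin n} {f g : Fin n → Fin 2}
    (hfg : AgreeOutside r j f g)
    (hocc : occupation (fun k : Fin r => f (shiftSite j k)) =
      occupation fun k : Fin r => g (shiftSite j k)) : occupation f = occupation g := by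
  classical
  have hinj : Set.InjOn (fun k : Fin r => shiftSite j k.val) (Finset.univ : Finset (Fin r)) :=
    fun a _ b _ hab => Fin.ext (shiftSite_right_injective j (by omega) (by omega) hab)
  set s := Finset.univ.image fun k : Fin r => shiftSite j k.val with hs
  have hsplit : ∀ u : Fin n → Fin 2, occupation u =
      occupation (fun k : Fin r => u (shiftSite j k)) + ∑ i ∈ sᶜ, (u i).val := by
    intro u
    rw [occupation, ← Finset.sum_add_sum_compl s, hs, Finset.sum_image hinj]
    rfl
  rw [hsplit f, hsplit g, hocc]
  congr 1
  refine Finset.sum_congr rfl fun i hi => ?_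
  rw [hfg i]
  rintro k rfl
  simp [hs] at hi

open Classical in
theorem crosscap_diagonal (L : ℕ) (c : ℂ) (g : Fin (2 * L) → Fin 2) :
    crosscap L 2 (Matrix.diagonal ![1, c]) g =
      if ∀ i, g (shiftSite i L) = g i then c ^ (occupation g / 2) else 0 := by
  have hiff : (∀ i, g (shiftSite i L) = g i) ↔ ∀ j : Fin L, g (lo j) = g (hi j) := by
    refine ⟨fun H j => by rw [← H (lo j), shiftSite_antipode_lo], fun H i => ?_⟩
    obtain ⟨j, rfl | rfl⟩ := eq_lo_or_eq_hi i
    · rw [shiftSite_antipode_lo, H]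
    · rw [shiftSite_antipode_hi, H]
  simp only [crosscap, diagonal_one_apply, Finset.prod_ite_zero, Finset.mem_univ, true_imp_iff,
    Finset.prod_pow_eq_pow_sum, hiff]
  split_ifs with H
  · rw [occupation, sum_eq_sum_lo_add_sum_hi]
    simp only [H]
    congr 1
    omega
  · rfl

/-- The reflection `g ↦ f + f ∘ antipode - g`, exchanging the antipodally symmetric states that
agree with `f` outside a window with those that agree with `f` outside the antipodal window. -/
def reflectState {L : ℕ} (f : Fin (2 * L) → Fin 2) :
    Equiv.Perm (Fin (2 * L) → Fin 2) :=
  Equiv.subLeft (f + f ∘ antipode L)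

theorem reflectState_apply {L : ℕ} (f g : Fin (2 * L) → Fin 2) (i : Fin (2 * L)) :
    reflectState f g i = f i + f (shiftSite i L) - g i := rfl

theorem reflectState_reflectState {L : ℕ} (f g : Fin (2 * L) → Fin 2) :
    reflectState f (reflectState f g) = g := by
  simp [reflectState]

theorem reflectState_symmetric {L : ℕ} {f g : Fin (2 * L) → Fin 2}
    (hg : ∀ i, g (shiftSite i L) = g i) (i : Fin (2 * L)) :
    reflectState f g (shiftSite i L) = reflectState f g i := by
  rw [reflectState_apply, reflectState_apply, hg, shiftSite_antipode_antipode, add_comm]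

/-- A site of a window of length at most `L` is antipodal to no site of that window. -/
theorem shiftSite_antipode_ne {L r : ℕ} (hr : r ≤ L) (j : Fin (2 * L)) (k l : Fin r) :
    shiftSite (shiftSite j k) L ≠ shiftSite j l := by
  rw [shiftSite_shiftSite]
  intro H
  have := shiftSite_right_injective j (by omega) (by omega) H
  omega

theorem AgreeOutside.apply_window {L r : ℕ} (hr : r ≤ L) {j : Fin (2 * L)}
    {f g : Fin (2 * L) → Fin 2} (hg : ∀ i, g (shiftSite i L) = g i)
    (hfg : AgreeOutside r j f g) (k : Fin r) :
    g (shiftSite j k) = f (shiftSite (shiftSite j k) L) := by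
  rw [← hg, hfg _ fun l => shiftSite_antipode_ne hr j k l]

theorem AgreeOutside.reflectState {L r : ℕ} (hr : r ≤ L) {j : Fin (2 * L)}
    {f g : Fin (2 * L) → Fin 2} (hg : ∀ i, g (shiftSite i L) = g i)
    (hfg : AgreeOutside r j f g) : AgreeOutside r (shiftSite j L) f (reflectState f g) := by
  intro i hi
  rw [reflectState_apply]
  by_cases hw : ∃ k : Fin r, i = shiftSite j k
  · obtain ⟨k, rfl⟩ := hw
    rw [hfg.apply_window hr hg, add_sub_cancel_right]
  · push Not at hw
    have hL : f (shiftSite i L) = g (shiftSite i L) := by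
      refine hfg _ fun k hk => hi k ?_
      rw [shiftSite_right_comm, ← hk, shiftSite_antipode_antipode]
    rw [hL, hg, add_sub_cancel_right]

theorem localOp_mul_crosscap_add_reflect {r L : ℕ} (hr : r ≤ L) (c : ℂ)
    {h : Matrix (Fin r → Fin 2) (Fin r → Fin 2) ℂ} (hanti : hᵀ = -h)
    (hcomm : h * (∑ k : Fin r, oneSite PZ k) = (∑ k : Fin r, oneSite PZ k) * h)
    (f g : Fin (2 * L) → Fin 2) (j : Fin (2 * L)) :
    localOp r h j f g * crosscap L 2 (Matrix.diagonal ![1, c]) g +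
      localOp r h (shiftSite j L) f (reflectState f g) *
        crosscap L 2 (Matrix.diagonal ![1, c]) (reflectState f g) = 0 := by
  classical
  have hsymm : (∀ i, reflectState f g (shiftSite i L) = reflectState f g i) ↔
      ∀ i, g (shiftSite i L) = g i :=
    ⟨fun H => by simpa only [reflectState_reflectState] using reflectState_symmetric (f := f) H,
      reflectState_symmetric⟩
  simp only [crosscap_diagonal, hsymm]
  split_ifs with hg
  swap
  · simp
  have hagree : AgreeOutside r (shiftSite j L) f (reflectState f g) ↔ AgreeOutside r j f g := by
    refine ⟨fun H => ?_, AgreeOutside.reflectState hr hg⟩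
    simpa only [reflectState_reflectState, shiftSite_antipode_antipode] using
      H.reflectState hr (reflectState_symmetric hg)
  simp only [localOp_apply, hagree]
  split_ifs with hfg
  swap
  · simp
  have hfg' := hagree.mpr hfg
  set u : Fin r → Fin 2 := fun k => f (shiftSite j k)
  set v : Fin r → Fin 2 := fun k => g (shiftSite j k)
  have hv' : (fun k : Fin r => f (shiftSite (shiftSite j L) k)) = v := by
    funext k
    rw [shiftSite_right_comm, ← hfg.apply_window hr hg]
  have hu' : (fun k : Fin r => reflectState f g (shiftSite (shiftSite j L) k)) = u := by
    funext k
    rw [hfg'.apply_window hr (reflectState_symmetric hg), shiftSite_right_comm,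
      shiftSite_antipode_antipode]
  have hvu : h v u = -h u v := congrFun (congrFun hanti u) v
  rw [hv', hu', hvu]
  by_cases huv : h u v = 0
  · simp [huv]
  have hocc := occupation_eq_of_commute hcomm huv
  rw [← hfg.occupation_eq (by omega) hocc,
    ← hfg'.occupation_eq (by omega) (by rw [hv', hu', hocc])]
  ring

/-- if the local operator `h` of range `r` on qubits is antisymmetric under
transposition (`hᵀ = -h`) and commutes with the charge `Σ_k Z_k` on its support, then for every
`c ∈ ℂ` and `A = diag(1, c)` the condition `A^{⊗r} h + hᵀ A^{⊗r} = 0` holds; consequently, for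
every `L ≥ r` the Hamiltonian `H = Σ_j h(j)` on a periodic chain of `2L` qubits annihilates the
crosscap state `|Ψ(c)⟩` built from `A = diag(1, c)`. -/
theorem u1_charge_gives_tunable_crosscap (r : ℕ)
    (h : Matrix (Fin r → Fin 2) (Fin r → Fin 2) ℂ)
    (hanti : hᵀ = -h)
    (hcomm : h * (∑ k : Fin r, oneSite PZ k) = (∑ k : Fin r, oneSite PZ k) * h) :
    ∀ c : ℂ,
      (kronPow r (Matrix.diagonal ![1, c]) * h +
        hᵀ * kronPow r (Matrix.diagonal ![1, c]) = 0) ∧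
      ∀ L : ℕ, r ≤ L →
        (∑ j : Fin (2 * L), localOp r h j).mulVec
          (crosscap L 2 (Matrix.diagonal ![1, c])) = 0 := by
  intro c
  constructor
  · ext f g
    rw [kronPow_diagonal, hanti, Matrix.add_apply, Matrix.diagonal_mul, Matrix.mul_diagonal,
      Matrix.neg_apply, Matrix.zero_apply]
    by_cases hfg : h f g = 0
    · simp [hfg]
    · rw [occupation_eq_of_commute hcomm hfg]
      ring
  · intro L hr
    funext f
    set F : Fin (2 * L) × (Fin (2 * L) → Fin 2) → ℂ := fun p =>
      localOp r h p.1 f p.2 * crosscap L 2 (Matrix.diagonal ![1, c]) p.2 with hF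
    have hmul : (∑ j : Fin (2 * L), localOp r h j).mulVec
        (crosscap L 2 (Matrix.diagonal ![1, c])) f = ∑ p, F p := by
      simp only [hF, Fintype.sum_prod_type, Matrix.sum_mulVec, Finset.sum_apply]
      rfl
    have hreflect : ∑ p, F p = -∑ p, F p := by
      conv_lhs => rw [← Equiv.sum_comp ((antipode L).prodCongr (reflectState f))]
      rw [← Finset.sum_neg_distrib]
      exact Finset.sum_congr rfl fun p _ => eq_neg_of_add_eq_zero_right
        (localOp_mul_crosscap_add_reflect hr c hanti hcomm f p.2 p.1)
    rw [hmul, Pi.zero_apply]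
    exact self_eq_neg.mp hreflect
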